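/- (Efficiency gain from matching on cluster size) Let (Ȳ(1),Ȳ(0),X,N) be as in the common setup and set Z = Ỹ(1)+Ỹ(0), which is square-integrable. Then ω² − ν² = −(1/2)(E[(E[Z|X])²] − E[(E[Z|X,N])²]), and by the law of iterated expectations and Jensen's (conditional Jensen's) inequality E[(E[Z|X])²] ≤ E[(E[Z|X,N])²]; consequently ω² ≥ ν². -/

import Mathlib

open MeasureTheory ProbabilityTheory Filter
open scoped ENNReal NNReal Topology

/-- If the conditional expectation of a nonnegative integrable `f` given `m` is essentially bounded,
then `g * f` is integrable for every nonnegative integrable `m`-measurable `g`. -/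
theorem integrable_mul_of_condExp_le {Ω : Type*} {m m₀ : MeasurableSpace Ω} {μ : Measure[m₀] Ω}
    [IsFiniteMeasure μ] (hm : m ≤ m₀) {f g : Ω → ℝ} {C : ℝ} (hf : Integrable f μ) (hf0 : 0 ≤ f)
    (hfC : ∀ᵐ ω ∂μ, (μ[f | m]) ω ≤ C) (hgm : Measurable[m] g) (hg : Integrable g μ) (hg0 : 0 ≤ g) :
    Integrable (fun ω => g ω * f ω) μ := by
  have hle : (μ.withDensity fun ω => ENNReal.ofReal (f ω)).trim hm
      ≤ ENNReal.ofReal C • μ.trim hm := by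
    refine Measure.le_iff.2 fun s hs => ?_
    rw [Measure.smul_apply, trim_measurableSet_eq hm hs, trim_measurableSet_eq hm hs,
      withDensity_apply _ (hm s hs), ← ofReal_integral_eq_lintegral_ofReal hf.restrict
        (Eventually.of_forall hf0), ← setIntegral_condExp hm hf hs, smul_eq_mul]
    calc ENNReal.ofReal (∫ ω in s, (μ[f | m]) ω ∂μ)
        ≤ ENNReal.ofReal (∫ _ in s, C ∂μ) :=
          ENNReal.ofReal_le_ofReal (setIntegral_mono_ae integrable_condExp.integrableOn
            (integrable_const C).integrableOn hfC)
      _ = ENNReal.ofReal C * μ s := by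
          rw [setIntegral_const, smul_eq_mul, mul_comm, ENNReal.ofReal_mul' measureReal_nonneg,
            ofReal_measureReal]
  have hgm' : Measurable[m] fun ω => ENNReal.ofReal (g ω) := hgm.ennreal_ofReal
  refine ⟨hg.1.mul hf.1, ?_⟩
  rw [hasFiniteIntegral_iff_ofReal (Eventually.of_forall fun ω => mul_nonneg (hg0 ω) (hf0 ω))]
  calc ∫⁻ ω, ENNReal.ofReal (g ω * f ω) ∂μ
      = ∫⁻ ω, ENNReal.ofReal (g ω) ∂(μ.withDensity fun ω => ENNReal.ofReal (f ω)) := by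
        rw [lintegral_withDensity_eq_lintegral_mul₀ hf.aemeasurable.ennreal_ofReal
          (hgm'.mono hm le_rfl).aemeasurable]
        refine lintegral_congr fun ω => ?_
        rw [Pi.mul_apply, mul_comm, ENNReal.ofReal_mul (hf0 ω)]
    _ = ∫⁻ ω, ENNReal.ofReal (g ω) ∂(μ.withDensity fun ω => ENNReal.ofReal (f ω)).trim hm :=
        (lintegral_trim hm hgm').symm
    _ ≤ ∫⁻ ω, ENNReal.ofReal (g ω) ∂(ENNReal.ofReal C • μ.trim hm) := lintegral_mono' hle le_rfl
    _ = ENNReal.ofReal C * ∫⁻ ω, ENNReal.ofReal (g ω) ∂μ := by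
        rw [lintegral_smul_measure, lintegral_trim hm hgm', smul_eq_mul]
    _ < ∞ := ENNReal.mul_lt_top ENNReal.ofReal_lt_top
        ((hasFiniteIntegral_iff_ofReal (Eventually.of_forall hg0)).1 hg.2)

/-- The second moment of the conditional expectation increases with the conditioning σ-algebra. -/
theorem integral_sq_condExp_mono {Ω : Type*} {m₁ m₂ m₀ : MeasurableSpace Ω} {μ : Measure[m₀] Ω}
    [IsFiniteMeasure μ] (h₁₂ : m₁ ≤ m₂) (h₂ : m₂ ≤ m₀) {Z : Ω → ℝ} (hZ : MemLp Z 2 μ) :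
    ∫ ω, ((μ[Z | m₁]) ω) ^ 2 ∂μ ≤ ∫ ω, ((μ[Z | m₂]) ω) ^ 2 ∂μ := by
  have hW : MemLp (μ[Z | m₂]) 2 μ := hZ.condExp one_le_two
  have hW₁ : μ[μ[Z | m₂] | m₁] =ᵐ[μ] μ[Z | m₁] := condExp_condExp_of_le h₁₂ h₂
  have hvar : 0 ≤ᵐ[μ] Var[μ[Z | m₂]; μ | m₁] :=
    condExp_nonneg (Eventually.of_forall fun ω => sq_nonneg _)
  calc ∫ ω, ((μ[Z | m₁]) ω) ^ 2 ∂μ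
      ≤ ∫ ω, (μ[(μ[Z | m₂]) ^ 2 | m₁]) ω ∂μ := by
        refine integral_mono_ae (hZ.condExp one_le_two).integrable_sq integrable_condExp ?_
        filter_upwards [hvar, hW₁, condVar_ae_eq_condExp_sq_sub_sq_condExp (h₁₂.trans h₂) hW]
          with ω h0 h1 h2
        simp only [Pi.sub_apply, Pi.pow_apply, Pi.zero_apply] at h0 h2 ⊢
        rw [h1] at h2
        linarith
    _ = ∫ ω, ((μ[Z | m₂]) ω) ^ 2 ∂μ := integral_condExp (h₁₂.trans h₂)

/-- **Efficiency gain from matching on cluster size.**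
Let `(Ȳ(1), Ȳ(0), X, N)` be as in the common setup and set `Z = Ỹ(1) + Ỹ(0)`.  Then
`ω² − ν² = −(1/2)(E[(E[Z|X])²] − E[(E[Z|X,N])²])`, moreover
`E[(E[Z|X])²] ≤ E[(E[Z|X,N])²]`, and consequently `ω² ≥ ν²`. -/
theorem efficiency_gain_from_matching_on_cluster_size
    {Ω : Type*} [MeasureSpace Ω] [IsProbabilityMeasure (ℙ : Measure Ω)]
    {k : ℕ} (Ybar : Fin 2 → Ω → ℝ) (X : Ω → EuclideanSpace ℝ (Fin k)) (N : Ω → ℕ)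
    (hYmeas : ∀ d, Measurable (Ybar d)) (hXmeas : Measurable X) (hNmeas : Measurable N)
    (hNpos : ∀ ω, 1 ≤ N ω)
    (hN2 : Integrable (fun ω => (N ω : ℝ) ^ 2) ℙ)
    (C : ℝ)
    (hYsqInt : ∀ d, Integrable (fun ω => (Ybar d ω) ^ 2) ℙ)
    (hYbound : ∀ d : Fin 2,
      ∀ᵐ ω ∂ℙ, (ℙ[fun ω' => (Ybar d ω') ^ 2 |
        MeasurableSpace.comap (fun ω' => (X ω', N ω')) inferInstance]) ω ≤ C)
    -- the transformed outcomes `Ỹ(d) = (N/E[N])(Ȳ(d) − E[Ȳ(d)N]/E[N])`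
    (Ytilde : Fin 2 → Ω → ℝ)
    (hYtilde : ∀ d ω, Ytilde d ω =
      ((N ω : ℝ) / 𝔼[fun ω' => (N ω' : ℝ)]) *
        (Ybar d ω - 𝔼[fun ω' => Ybar d ω' * (N ω' : ℝ)] / 𝔼[fun ω' => (N ω' : ℝ)]))
    -- `Z = Ỹ(1) + Ỹ(0)`
    (Z : Ω → ℝ) (hZ : ∀ ω, Z ω = Ytilde 1 ω + Ytilde 0 ω)
    -- `ω²` and `ν²`
    (ω2 ν2 : ℝ)
    (hω2 : ω2 = 𝔼[fun ω => (Ytilde 1 ω) ^ 2] + 𝔼[fun ω => (Ytilde 0 ω) ^ 2]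
      - (1 / 2) * 𝔼[fun ω => ((ℙ[Z | MeasurableSpace.comap X inferInstance]) ω) ^ 2])
    (hν2 : ν2 = 𝔼[fun ω => (Ytilde 1 ω) ^ 2] + 𝔼[fun ω => (Ytilde 0 ω) ^ 2]
      - (1 / 2) * 𝔼[fun ω =>
          ((ℙ[Z | MeasurableSpace.comap (fun ω' => (X ω', N ω')) inferInstance]) ω) ^ 2]) :
    ω2 - ν2 = -(1 / 2) *
        (𝔼[fun ω => ((ℙ[Z | MeasurableSpace.comap X inferInstance]) ω) ^ 2]
          - 𝔼[fun ω =>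
              ((ℙ[Z | MeasurableSpace.comap (fun ω' => (X ω', N ω')) inferInstance]) ω) ^ 2])
      ∧ 𝔼[fun ω => ((ℙ[Z | MeasurableSpace.comap X inferInstance]) ω) ^ 2]
          ≤ 𝔼[fun ω =>
              ((ℙ[Z | MeasurableSpace.comap (fun ω' => (X ω', N ω')) inferInstance]) ω) ^ 2]
      ∧ ν2 ≤ ω2 := by
  have hXN : Measurable fun ω' => (X ω', N ω') := hXmeas.prodMk hNmeas
  have hXm : MeasurableSpace.comap X inferInstance
      ≤ MeasurableSpace.comap (fun ω' => (X ω', N ω')) inferInstance :=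
    (measurable_fst.comp (comap_measurable fun ω' => (X ω', N ω'))).comap_le
  have hNm : Measurable[MeasurableSpace.comap (fun ω' => (X ω', N ω')) inferInstance]
      fun ω => (N ω : ℝ) ^ 2 :=
    ((measurable_from_top (f := fun n : ℕ => (n : ℝ) ^ 2)).comp measurable_snd).comp
      (comap_measurable fun ω' => (X ω', N ω'))
  have hNreal : Measurable fun ω => (N ω : ℝ) := measurable_from_top.comp hNmeas
  have hN : MemLp (fun ω => (N ω : ℝ)) 2 ℙ :=
    (memLp_two_iff_integrable_sq hNreal.aestronglyMeasurable).2 hN2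
  have hNY (d : Fin 2) : MemLp (fun ω => (N ω : ℝ) * Ybar d ω) 2 ℙ := by
    refine (memLp_two_iff_integrable_sq (hNreal.mul (hYmeas d)).aestronglyMeasurable).2 ?_
    simp only [Pi.mul_apply, mul_pow]
    exact integrable_mul_of_condExp_le hXN.comap_le (hYsqInt d) (fun ω => sq_nonneg _)
      (hYbound d) hNm hN2 (fun ω => sq_nonneg _)
  have hYt (d : Fin 2) : MemLp (Ytilde d) 2 ℙ := by
    set a := 𝔼[fun ω' => (N ω' : ℝ)]
    set b := 𝔼[fun ω' => Ybar d ω' * (N ω' : ℝ)] / a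
    convert ((hNY d).const_mul a⁻¹).sub (hN.const_mul (a⁻¹ * b)) using 1
    ext ω
    simp only [hYtilde d ω, Pi.sub_apply]
    ring
  have hZ2 : MemLp Z 2 ℙ := by
    rw [funext hZ]
    exact (hYt 1).add (hYt 0)
  have hle := integral_sq_condExp_mono hXm hXN.comap_le hZ2
  refine ⟨?_, hle, ?_⟩
  · rw [hω2, hν2]
    ring
  · rw [hω2, hν2]
    linarith
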